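/- arXiv:2312.06548 — 2 statements merged into one kernel-verified Lean document; each statement's English description precedes it below -/
import Mathlib

section
/- Let α ∈ (0,1) be irrational and let N be an integer with q_n ≤ N < q_{n+1} and Ostrowski expansion N = Σ_{ℓ=0}^{n} b_ℓ q_ℓ. If 0 ≤ k ≤ n is an index with b_k ≥ 2, then for every t with 1 ≤ t ≤ b_k − 1 one has ε_{k,t}(N) ≥ λ_{k,1} = q_k δ_{k+1} > 0. -/
/-- The Gauss map `x ↦ {1/x}`. -/
noncomputable def gaussMap (x : ℝ) : ℝ := Int.fract x⁻¹

/-- `pq α i` is the `i`-th partial quotient `aᵢ` of the continued fraction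
expansion `α = [0; a₁, a₂, …]` of an irrational `α ∈ (0,1)` (meaningful for `i ≥ 1`). -/
noncomputable def pq (α : ℝ) (i : ℕ) : ℕ := ⌊(gaussMap^[i - 1] α)⁻¹⌋₊

/-- `qden α k` is the denominator `q_k` of the `k`-th convergent of `α`:
`q₀ = 1`, `q₁ = a₁`, `q_{k+2} = a_{k+2} q_{k+1} + q_k`. -/
noncomputable def qden (α : ℝ) : ℕ → ℕ
  | 0 => 1
  | 1 => pq α 1
  | (k + 2) => pq α (k + 2) * qden α (k + 1) + qden α k

/-- Distance to the nearest integer. -/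
noncomputable def nint (x : ℝ) : ℝ := |x - round x|

/-- `δ_k = ‖q_k α‖`. -/
noncomputable def dlt (α : ℝ) (k : ℕ) : ℝ := nint (qden α k * α)

/-- `ε_{i,t}(N) = q_i (t δ_i + Σ_{j=1}^{n-i} (-1)^j b_{i+j} δ_{i+j})`,
where `b` are the Ostrowski digits of `N` with top index `n`. -/
noncomputable def eps (α : ℝ) (b : ℕ → ℕ) (n i t : ℕ) : ℝ :=
  (qden α i : ℝ) *
    (t * dlt α i + ∑ j ∈ Finset.Icc 1 (n - i), (-1 : ℝ) ^ j * b (i + j) * dlt α (i + j))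

/-- The products `α · G(α) ⋯ Gᵏ(α)` over the Gauss map orbit; they equal `|q_k α - p_k|`. -/
noncomputable def gaussProd (α : ℝ) (k : ℕ) : ℝ := ∏ i ∈ Finset.range (k + 1), gaussMap^[i] α

lemma gaussMap_iterate_mem {α : ℝ} (h0 : 0 < α) (h1 : α < 1) (hirr : Irrational α) (i : ℕ) :
    0 < gaussMap^[i] α ∧ gaussMap^[i] α < 1 ∧ Irrational (gaussMap^[i] α) := by
  induction i with
  | zero => exact ⟨h0, h1, hirr⟩
  | succ i ih =>
    have hi : Irrational (gaussMap^[i + 1] α) := by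
      rw [Function.iterate_succ_apply', gaussMap, Int.fract]
      exact (irrational_inv_iff.2 ih.2.2).sub_intCast _
    refine ⟨lt_of_le_of_ne ?_ hi.ne_zero.symm, ?_, hi⟩ <;>
      rw [Function.iterate_succ_apply', gaussMap]
    · exact Int.fract_nonneg _
    · exact Int.fract_lt_one _

lemma inv_gaussMap_iterate {α : ℝ} (h0 : 0 < α) (h1 : α < 1) (hirr : Irrational α) (i : ℕ) :
    (gaussMap^[i] α)⁻¹ = pq α (i + 1) + gaussMap^[i + 1] α := by
  have hpos := (gaussMap_iterate_mem h0 h1 hirr i).1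
  rw [Function.iterate_succ_apply', gaussMap, pq, Nat.add_sub_cancel,
    natCast_floor_eq_intCast_floor (inv_nonneg.2 hpos.le), Int.floor_add_fract]

lemma one_le_pq_succ {α : ℝ} (h0 : 0 < α) (h1 : α < 1) (hirr : Irrational α) (i : ℕ) :
    1 ≤ pq α (i + 1) := by
  have h := gaussMap_iterate_mem h0 h1 hirr i
  rw [pq, Nat.add_sub_cancel, Nat.one_le_floor_iff]
  exact (one_le_inv₀ h.1).2 h.2.1.le

lemma gaussProd_pos {α : ℝ} (h0 : 0 < α) (h1 : α < 1) (hirr : Irrational α) (k : ℕ) :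
    0 < gaussProd α k :=
  Finset.prod_pos fun i _ => (gaussMap_iterate_mem h0 h1 hirr i).1

lemma gaussProd_zero (α : ℝ) : gaussProd α 0 = α := by simp [gaussProd]

lemma gaussProd_succ (α : ℝ) (k : ℕ) :
    gaussProd α (k + 1) = gaussProd α k * gaussMap^[k + 1] α :=
  Finset.prod_range_succ _ _

lemma gaussProd_one {α : ℝ} (h0 : 0 < α) (h1 : α < 1) (hirr : Irrational α) :
    pq α 1 * α + gaussProd α 1 = 1 := by
  have h := inv_gaussMap_iterate h0 h1 hirr 0
  rw [Function.iterate_zero, id_eq, zero_add] at h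
  rw [gaussProd_succ, gaussProd_zero, zero_add, mul_comm, ← mul_add, ← h,
    mul_inv_cancel₀ h0.ne']

lemma gaussProd_rec {α : ℝ} (h0 : 0 < α) (h1 : α < 1) (hirr : Irrational α) (k : ℕ) :
    gaussProd α k = pq α (k + 2) * gaussProd α (k + 1) + gaussProd α (k + 2) := by
  have h := inv_gaussMap_iterate h0 h1 hirr (k + 1)
  have hpos := (gaussMap_iterate_mem h0 h1 hirr (k + 1)).1
  rw [gaussProd_succ α (k + 1), mul_comm, ← mul_add, ← h, gaussProd_succ α k,
    mul_inv_cancel_right₀ hpos.ne']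

lemma gaussProd_succ_lt {α : ℝ} (h0 : 0 < α) (h1 : α < 1) (hirr : Irrational α) (k : ℕ) :
    gaussProd α (k + 1) < gaussProd α k := by
  rw [gaussProd_succ]
  exact mul_lt_of_lt_one_right (gaussProd_pos h0 h1 hirr k)
    (gaussMap_iterate_mem h0 h1 hirr (k + 1)).2.1

lemma gaussProd_succ_lt_half {α : ℝ} (h0 : 0 < α) (h1 : α < 1) (hirr : Irrational α) (k : ℕ) :
    gaussProd α (k + 1) < 1 / 2 := by
  induction k with
  | zero =>
    have h := gaussProd_one h0 h1 hirr
    have ha : (1 : ℝ) ≤ pq α 1 := by exact_mod_cast one_le_pq_succ h0 h1 hirr 0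
    have hlt := gaussProd_succ_lt h0 h1 hirr 0
    rw [gaussProd_zero] at hlt
    rw [zero_add] at hlt ⊢
    nlinarith
  | succ k ih => exact (gaussProd_succ_lt h0 h1 hirr (k + 1)).trans ih

lemma exists_qden_mul_eq {α : ℝ} (h0 : 0 < α) (h1 : α < 1) (hirr : Irrational α) (k : ℕ) :
    ∃ p : ℤ, qden α k * α = p + (-1) ^ k * gaussProd α k := by
  induction k using Nat.twoStepInduction with
  | zero => exact ⟨0, by simp [qden, gaussProd_zero]⟩
  | one =>
    refine ⟨1, ?_⟩
    rw [qden]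
    push_cast
    linarith [gaussProd_one h0 h1 hirr]
  | more k ih₀ ih₁ =>
    obtain ⟨p, hp⟩ := ih₀
    obtain ⟨r, hr⟩ := ih₁
    refine ⟨pq α (k + 2) * r + p, ?_⟩
    rw [qden]
    push_cast
    linear_combination (pq α (k + 2) : ℝ) * hr + hp + (-1) ^ k * gaussProd_rec h0 h1 hirr k

lemma nint_intCast_add {s : ℝ} (p : ℤ) (hs : |s| < 1 / 2) : nint (p + s) = |s| := by
  have h : round s = 0 := by
    rw [round_eq_zero_iff]
    constructor <;> linarith [abs_lt.1 hs]
  rw [nint, round_intCast_add, h]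
  simp

lemma dlt_eq_gaussProd {α : ℝ} (h0 : 0 < α) (h1 : α < 1) (hirr : Irrational α) {k : ℕ}
    (hk : gaussProd α k < 1 / 2) : dlt α k = gaussProd α k := by
  obtain ⟨p, hp⟩ := exists_qden_mul_eq h0 h1 hirr k
  have habs : |(-1) ^ k * gaussProd α k| = gaussProd α k := by
    rw [abs_mul, abs_neg_one_pow, one_mul, abs_of_pos (gaussProd_pos h0 h1 hirr k)]
  rw [dlt, hp, nint_intCast_add p (habs.trans_lt hk), habs]

lemma qden_pos {α : ℝ} (h0 : 0 < α) (h1 : α < 1) (hirr : Irrational α) (k : ℕ) :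
    0 < qden α k := by
  induction k using Nat.twoStepInduction with
  | zero => exact Nat.one_pos
  | one => exact one_le_pq_succ h0 h1 hirr 0
  | more k ih₀ _ => exact Nat.add_pos_right _ ih₀

/-- Splitting off the first term of an alternating tail sum. -/
lemma sum_Icc_alternating_succ (f : ℕ → ℝ) (i m : ℕ) :
    ∑ j ∈ Finset.Icc 1 (m + 1), (-1 : ℝ) ^ j * f (i + j) =
      -f (i + 1) - ∑ j ∈ Finset.Icc 1 m, (-1 : ℝ) ^ j * f (i + 1 + j) := by
  simp only [← Finset.Ico_add_one_right_eq_Icc, Finset.sum_Ico_eq_sum_range,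
    Nat.add_sub_cancel]
  rw [Finset.sum_range_succ', sub_eq_add_neg, ← Finset.sum_neg_distrib, add_comm]
  congr 1
  · simp
  · refine Finset.sum_congr rfl fun j _ => ?_
    rw [show i + (1 + (j + 1)) = i + 1 + (1 + j) by ring]
    ring

/-- Alternating sums of digits bounded by the partial quotients. -/
lemma alternating_digit_sum_mem {α : ℝ} (h0 : 0 < α) (h1 : α < 1) (hirr : Irrational α)
    {b : ℕ → ℕ} {n : ℕ} (hb : ∀ ℓ, 1 ≤ ℓ → ℓ ≤ n → b ℓ ≤ pq α (ℓ + 1)) {i m : ℕ}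
    (him : i + m ≤ n) :
    ∑ j ∈ Finset.Icc 1 m, (-1 : ℝ) ^ j * (b (i + j) * gaussProd α (i + j)) ∈
      Set.Icc (-gaussProd α i) (gaussProd α (i + 1)) := by
  induction m generalizing i with
  | zero => simp [(gaussProd_pos h0 h1 hirr _).le]
  | succ m ih =>
    obtain ⟨hl, hu⟩ := ih (i := i + 1) (by omega)
    have hpos := gaussProd_pos h0 h1 hirr (i + 1)
    have hbi : (b (i + 1) : ℝ) ≤ pq α (i + 2) := by
      exact_mod_cast hb (i + 1) (by omega) (by omega)
    have hmul := mul_le_mul_of_nonneg_right hbi hpos.le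
    have hnn : 0 ≤ (b (i + 1) : ℝ) * gaussProd α (i + 1) := by positivity
    rw [sum_Icc_alternating_succ (fun l => b l * gaussProd α l)]
    have hrec := gaussProd_rec h0 h1 hirr i
    constructor <;> linarith

/-- If `b_k ≥ 2` and `1 ≤ t ≤ b_k - 1`, then `ε_{k,t}(N) ≥ λ_{k,1} = q_k δ_{k+1} > 0`. -/
theorem eps_pos_of_t_ge_one
    (α : ℝ) (h0 : 0 < α) (h1 : α < 1) (hirr : Irrational α)
    (n N : ℕ) (b : ℕ → ℕ)
    (hqN : qden α n ≤ N) (hNq : N < qden α (n + 1))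
    (hN : N = ∑ ℓ ∈ Finset.range (n + 1), b ℓ * qden α ℓ)
    (hbn : 1 ≤ b n) (hb0 : b 0 < pq α 1)
    (hb : ∀ ℓ, 1 ≤ ℓ → ℓ ≤ n → b ℓ ≤ pq α (ℓ + 1))
    (hbz : ∀ ℓ, 1 ≤ ℓ → ℓ ≤ n → b ℓ = pq α (ℓ + 1) → b (ℓ - 1) = 0)
    (k : ℕ) (hk : k ≤ n) (hbk : 2 ≤ b k) (t : ℕ) (ht1 : 1 ≤ t) (ht : t ≤ b k - 1) :
    (qden α k : ℝ) * dlt α (k + 1) ≤ eps α b n k t ∧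
    0 < (qden α k : ℝ) * dlt α (k + 1) := by
  have hdk : gaussProd α k < 1 / 2 := by
    cases k with
    | zero =>
      have ha : (2 : ℝ) ≤ pq α 1 := by exact_mod_cast hbk.trans hb0.le
      have h := gaussProd_one h0 h1 hirr
      have hpos := gaussProd_pos h0 h1 hirr 1
      rw [gaussProd_zero]
      nlinarith
    | succ k => exact gaussProd_succ_lt_half h0 h1 hirr k
  have hd := dlt_eq_gaussProd h0 h1 hirr hdk
  have hds (j : ℕ) : dlt α (j + 1) = gaussProd α (j + 1) :=
    dlt_eq_gaussProd h0 h1 hirr (gaussProd_succ_lt_half h0 h1 hirr j)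
  have hq : (0 : ℝ) < qden α k := by exact_mod_cast qden_pos h0 h1 hirr k
  rw [hds k]
  refine ⟨?_, mul_pos hq (gaussProd_pos h0 h1 hirr _)⟩
  have hsum : ∑ j ∈ Finset.Icc 1 (n - k), (-1 : ℝ) ^ j * b (k + j) * dlt α (k + j) =
      ∑ j ∈ Finset.Icc 1 (n - k), (-1 : ℝ) ^ j * (b (k + j) * gaussProd α (k + j)) := by
    refine Finset.sum_congr rfl fun j hj => ?_
    obtain ⟨l, rfl⟩ := Nat.exists_eq_add_of_le' (Finset.mem_Icc.1 hj).1
    rw [← add_assoc, hds, mul_assoc]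
  rw [eps, hd, hsum]
  refine mul_le_mul_of_nonneg_left ?_ hq.le
  have htd : gaussProd α k ≤ t * gaussProd α k :=
    le_mul_of_one_le_left (gaussProd_pos h0 h1 hirr k).le (by exact_mod_cast ht1)
  rcases hm : n - k with _ | m
  · simpa using (gaussProd_succ_lt h0 h1 hirr k).le.trans htd
  · have hb1 : b (k + 1) + 1 ≤ pq α (k + 2) := by
      refine Nat.lt_of_le_of_ne (hb (k + 1) (by omega) (by omega)) fun h => ?_
      have hz := hbz (k + 1) (by omega) (by omega) h
      rw [Nat.add_sub_cancel] at hz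
      omega
    have hb1' : (b (k + 1) : ℝ) + 1 ≤ pq α (k + 2) := by exact_mod_cast hb1
    have hmul := mul_le_mul_of_nonneg_right hb1' (gaussProd_pos h0 h1 hirr (k + 1)).le
    rw [sum_Icc_alternating_succ (fun l => b l * gaussProd α l)]
    have hu := (alternating_digit_sum_mem h0 h1 hirr hb
      (i := k + 1) (m := m) (by omega)).2
    have hrec := gaussProd_rec h0 h1 hirr k
    linarith
end

section
/- For every pattern c = (c_1, …, c_9) ∈ {1,2,3}^9 one has λ_c^max − λ_c^min ≤ 6/(25 (c_5 + 1/2)²) and λ_{c,1}^min ≥ 1/(4.6 (c_5 + 1)). -/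
/-- `cfval [b₁, …, b_m] t` is the value of the continued fraction
`[0; b₁, …, b_m, tail]` whose tail `[0; tail]` has value `t`, i.e.
`1/(b₁ + 1/(b₂ + ⋯ + 1/(b_m + t)))`. -/
noncomputable def cfval : List ℕ → ℝ → ℝ
  | [], t => t
  | a :: l, t => ((a : ℝ) + cfval l t)⁻¹

/-- The value `[0; \overline{3,1}] = (√21 - 3)/6`. -/
noncomputable def x31 : ℝ := (Real.sqrt 21 - 3) / 6

/-- The value `[0; \overline{1,3}] = (√21 - 3)/2`. -/
noncomputable def x13 : ℝ := (Real.sqrt 21 - 3) / 2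

/-- `c⃗_min = [c₅; c₆, c₇, c₈, c₉, \overline{3,1}]`. -/
noncomputable def vecMin (c : Fin 9 → ℕ) : ℝ := (c 4 : ℝ) + cfval [c 5, c 6, c 7, c 8] x31

/-- `c⃗_max = [c₅; c₆, c₇, c₈, c₉, \overline{1,3}]`. -/
noncomputable def vecMax (c : Fin 9 → ℕ) : ℝ := (c 4 : ℝ) + cfval [c 5, c 6, c 7, c 8] x13

/-- `⃖c_min = [0; c₄, c₃, c₂, c₁, \overline{3,1}]`. -/
noncomputable def cevMin (c : Fin 9 → ℕ) : ℝ := cfval [c 3, c 2, c 1, c 0] x31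

/-- `⃖c_max = [0; c₄, c₃, c₂, c₁, \overline{1,3}]`. -/
noncomputable def cevMax (c : Fin 9 → ℕ) : ℝ := cfval [c 3, c 2, c 1, c 0] x13

/-- `λ_c^min = 1/(c⃗_max + ⃖c_max)`. -/
noncomputable def lamMin (c : Fin 9 → ℕ) : ℝ := (vecMax c + cevMax c)⁻¹

/-- `λ_c^max = 1/(c⃗_min + ⃖c_min)`. -/
noncomputable def lamMax (c : Fin 9 → ℕ) : ℝ := (vecMin c + cevMin c)⁻¹

/-- `λ_{c,1}^min = (1/(c₅ + ⃖c_max)) · 1/([c₆; c₇, c₈, c₉, \overline{3,1}] + [0; c₅, c₄, c₃, c₂, c₁, \overline{3,1}])`. -/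
noncomputable def lam1Min (c : Fin 9 → ℕ) : ℝ :=
  ((c 4 : ℝ) + cevMax c)⁻¹ *
    (((c 5 : ℝ) + cfval [c 6, c 7, c 8] x31) + cfval [c 4, c 3, c 2, c 1, c 0] x31)⁻¹

theorem sqrt_21_bounds : (4.582 : ℝ) < √21 ∧ √21 < 4.583 := by
  constructor
  · rw [Real.lt_sqrt (by norm_num)]; norm_num
  · rw [Real.sqrt_lt' (by norm_num)]; norm_num

theorem x31_bounds : (0.26 : ℝ) < x31 ∧ x31 < 0.264 := by
  have := sqrt_21_bounds
  unfold x31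
  constructor <;> linarith

theorem x13_bounds : (0.79 : ℝ) < x13 ∧ x13 < 0.792 := by
  have := sqrt_21_bounds
  unfold x13
  constructor <;> linarith

theorem inv_one_add_x31 : (1 + x31)⁻¹ = x13 := by
  refine inv_eq_of_mul_eq_one_right ?_
  have h : √(21 : ℝ) * √21 = 21 := Real.mul_self_sqrt (by norm_num)
  unfold x31 x13
  linarith

theorem inv_three_add_x13 : (3 + x13)⁻¹ = x31 := by
  refine inv_eq_of_mul_eq_one_right ?_
  have h : √(21 : ℝ) * √21 = 21 := Real.mul_self_sqrt (by norm_num)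
  unfold x31 x13
  linarith

/-- The interval `[x31, x13]` is invariant under `t ↦ (a + t)⁻¹` for `1 ≤ a ≤ 3`. -/
theorem cfval_mem_Icc {l : List ℕ} (hl : ∀ a ∈ l, 1 ≤ a ∧ a ≤ 3) {t : ℝ}
    (ht : t ∈ Set.Icc x31 x13) : cfval l t ∈ Set.Icc x31 x13 := by
  induction l with
  | nil => exact ht
  | cons a l ih =>
    obtain ⟨h₁, h₂⟩ := ih fun b hb => hl b (List.mem_cons_of_mem a hb)
    obtain ⟨ha₁, ha₃⟩ := hl a List.mem_cons_self
    have ha₁' : (1 : ℝ) ≤ a := by exact_mod_cast ha₁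
    have ha₃' : (a : ℝ) ≤ 3 := by exact_mod_cast ha₃
    have := x31_bounds.1
    simp only [cfval]
    constructor
    · rw [← inv_three_add_x13]
      exact inv_anti₀ (by linarith) (by linarith)
    · rw [← inv_one_add_x31]
      exact inv_anti₀ (by linarith) (by linarith)

theorem abs_inv_sub_inv_le {x y : ℝ} (hx : 5 / 4 ≤ x) (hy : 5 / 4 ≤ y) :
    |x⁻¹ - y⁻¹| ≤ 16 / 25 * |x - y| := by
  have hxy : (25 / 16 : ℝ) ≤ x * y := by nlinarith
  rw [inv_sub_inv (by positivity) (by positivity), abs_div, abs_sub_comm y x,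
    abs_of_pos (show 0 < x * y by positivity), div_le_iff₀ (by positivity)]
  nlinarith [abs_nonneg (x - y)]

theorem abs_cfval_sub_cfval_le {l : List ℕ} (hl : ∀ a ∈ l, 1 ≤ a ∧ a ≤ 3) {s t : ℝ}
    (hs : s ∈ Set.Icc x31 x13) (ht : t ∈ Set.Icc x31 x13) :
    |cfval l s - cfval l t| ≤ (16 / 25) ^ l.length * |s - t| := by
  induction l with
  | nil => simp [cfval]
  | cons a l ih =>
    have hl' : ∀ b ∈ l, 1 ≤ b ∧ b ≤ 3 := fun b hb => hl b (List.mem_cons_of_mem a hb)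
    have ha : (1 : ℝ) ≤ a := by exact_mod_cast (hl a List.mem_cons_self).1
    have h₁ := (cfval_mem_Icc hl' hs).1
    have h₂ := (cfval_mem_Icc hl' ht).1
    have := x31_bounds.1
    have h := abs_inv_sub_inv_le (x := a + cfval l s) (y := a + cfval l t)
      (by linarith) (by linarith)
    rw [add_sub_add_left_eq_sub] at h
    simp only [cfval, List.length_cons, pow_succ]
    linarith [ih hl']

theorem lamMax_sub_lamMin_le {c : Fin 9 → ℕ} (hc : ∀ i, 1 ≤ c i ∧ c i ≤ 3) :
    lamMax c - lamMin c ≤ 6 / (25 * ((c 4 : ℝ) + 1 / 2) ^ 2) := by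
  have b31 := x31_bounds
  have b13 := x13_bounds
  have m31 : x31 ∈ Set.Icc x31 x13 := ⟨le_rfl, by linarith⟩
  have m13 : x13 ∈ Set.Icc x31 x13 := ⟨by linarith, le_rfl⟩
  have hv : ∀ a ∈ [c 5, c 6, c 7, c 8], 1 ≤ a ∧ a ≤ 3 := by simp [hc]
  have hw : ∀ a ∈ [c 3, c 2, c 1, c 0], 1 ≤ a ∧ a ≤ 3 := by simp [hc]
  have hv₁ := (cfval_mem_Icc hv m31).1
  have hv₂ := (cfval_mem_Icc hv m13).1
  have hw₁ := (cfval_mem_Icc hw m31).1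
  have hw₂ := (cfval_mem_Icc hw m13).1
  have dv := (le_abs_self _).trans (abs_cfval_sub_cfval_le hv m13 m31)
  have dw := (le_abs_self _).trans (abs_cfval_sub_cfval_le hw m13 m31)
  rw [abs_of_pos (show 0 < x13 - x31 by linarith)] at dv dw
  norm_num at dv dw
  have hc₀ : (0 : ℝ) ≤ c 4 := Nat.cast_nonneg _
  have hP : (c 4 : ℝ) + 1 / 2 ≤ vecMin c + cevMin c := by unfold vecMin cevMin; linarith
  have hQ : (c 4 : ℝ) + 1 / 2 ≤ vecMax c + cevMax c := by unfold vecMax cevMax; linarith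
  have hQP : vecMax c + cevMax c - (vecMin c + cevMin c) ≤ 6 / 25 := by
    unfold vecMax cevMax vecMin cevMin; linarith
  have hr : 0 < (c 4 : ℝ) + 1 / 2 := by positivity
  unfold lamMax lamMin
  rw [inv_sub_inv (by linarith) (by linarith), ← div_div 6, sq]
  exact div_le_div₀ (by norm_num) hQP (by positivity)
    (mul_le_mul hP hQ hr.le (hr.trans_le hP).le)

theorem le_lam1Min {c : Fin 9 → ℕ} (hc : ∀ i, 1 ≤ c i ∧ c i ≤ 3) :
    1 / (4.6 * ((c 4 : ℝ) + 1)) ≤ lam1Min c := by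
  have b31 := x31_bounds
  have b13 := x13_bounds
  have m31 : x31 ∈ Set.Icc x31 x13 := ⟨le_rfl, by linarith⟩
  have m13 : x13 ∈ Set.Icc x31 x13 := ⟨by linarith, le_rfl⟩
  have hw : ∀ a ∈ [c 3, c 2, c 1, c 0], 1 ≤ a ∧ a ≤ 3 := by simp [hc]
  have hu : ∀ a ∈ [c 6, c 7, c 8], 1 ≤ a ∧ a ≤ 3 := by simp [hc]
  obtain ⟨hw₁, hw₂⟩ := cfval_mem_Icc hw m13
  obtain ⟨hu₁, hu₂⟩ := cfval_mem_Icc hu m31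
  have hz := (cfval_mem_Icc hw m31).1
  have h₄ : (1 : ℝ) ≤ c 4 := by exact_mod_cast (hc 4).1
  have h₅ : (1 : ℝ) ≤ c 5 := by exact_mod_cast (hc 5).1
  have h₅' : (c 5 : ℝ) ≤ 3 := by exact_mod_cast (hc 5).2
  have hB₀ : 0 < cfval [c 4, c 3, c 2, c 1, c 0] x31 := by
    rw [cfval]
    exact inv_pos.mpr (by linarith)
  have hB : cfval [c 4, c 3, c 2, c 1, c 0] x31 ≤ 4 / 5 := by
    rw [cfval, inv_le_comm₀ (by linarith) (by norm_num)]
    linarith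
  unfold lam1Min cevMax
  rw [← mul_inv, ← one_div]
  refine one_div_le_one_div_of_le (mul_pos (by linarith) (by linarith)) ?_
  rw [mul_comm]
  refine mul_le_mul ?_ ?_ ?_ ?_ <;> linarith

/-- For every pattern `c ∈ {1,2,3}⁹`:
`λ_c^max - λ_c^min ≤ 6/(25(c₅ + 1/2)²)` and `λ_{c,1}^min ≥ 1/(4.6(c₅ + 1))`. -/
theorem lam_diff_and_lam1Min_bounds
    (c : Fin 9 → ℕ) (hc : ∀ i, c i ∈ ({1, 2, 3} : Set ℕ)) :
    lamMax c - lamMin c ≤ 6 / (25 * ((c 4 : ℝ) + 1 / 2) ^ 2) ∧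
    1 / (4.6 * ((c 4 : ℝ) + 1)) ≤ lam1Min c := by
  have hc' : ∀ i, 1 ≤ c i ∧ c i ≤ 3 := fun i => by
    have := hc i
    simp only [Set.mem_insert_iff, Set.mem_singleton_iff] at this
    lia
  exact ⟨lamMax_sub_lamMin_le hc', le_lam1Min hc'⟩
end
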